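/- arXiv:2310.11387 — 2 statements merged into one kernel-verified Lean document; each statement's English description precedes it below -/
import Mathlib

section
/- Let E₁ = {x ∈ E : τ_x is type 1}, E₂ = {y ∈ E : τ_y is type 2}, and 𝓛ᵢ = {A ∩ Eᵢ : A ∈ 𝓛} for i = 1, 2. Suppose that every product σ of type 1 toggles has the property that whenever σ(𝓑) = 𝓑 for some block 𝓑, σ fixes every element of 𝓑. Then 𝓛 = 𝓛₁ ⊗ 𝓛₂ (i.e., 𝓛 = {X₁ ∪ X₂ : X₁ ∈ 𝓛₁, X₂ ∈ 𝓛₂}), |𝓛₁| equals the number of blocks, and |𝓛₂| equals the common size of the blocks. -/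
open scoped symmDiff

namespace TogglePaper

variable {E : Type*} [DecidableEq E]

/-- The toggle `τ_e` on the collection `L` of subsets of the ground set. -/
def toggle (L : Finset (Finset E)) (e : E) : Equiv.Perm {A : Finset E // A ∈ L} :=
  Function.Involutive.toPerm
    (fun X => if h : X.1 ∆ ({e} : Finset E) ∈ L then ⟨X.1 ∆ ({e} : Finset E), h⟩ else X)
    (by
      intro X
      by_cases h : X.1 ∆ ({e} : Finset E) ∈ L
      · have h2 : (X.1 ∆ ({e} : Finset E)) ∆ ({e} : Finset E) = X.1 :=
          symmDiff_symmDiff_cancel_right _ _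
        simp only [dif_pos h, h2]
        simp [h2, X.2]
      · simp [h])

/-- The generalized toggle group `T(L)`. -/
def toggleGroup (L : Finset (Finset E)) : Subgroup (Equiv.Perm {A : Finset E // A ∈ L}) :=
  Subgroup.closure (Set.range (toggle L))

/-- `T(L)` acts transitively on `L`. -/
def IsTransitive (L : Finset (Finset E)) : Prop :=
  ∀ A B : {A : Finset E // A ∈ L}, ∃ g ∈ toggleGroup L, g A = B

/-- `B` is a block for the action of `T(L)` on `L`. -/
def IsBlock (L : Finset (Finset E)) (B : Finset {A : Finset E // A ∈ L}) : Prop :=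
  ∀ g ∈ toggleGroup L, Finset.image g B = B ∨ Disjoint (Finset.image g B) B

/-- `Blocks` is a block system for `T(L)`: a partition of `L` into nonempty blocks
that is permuted by every element of `T(L)`. -/
def IsBlockSystem (L : Finset (Finset E))
    (Blocks : Finset (Finset {A : Finset E // A ∈ L})) : Prop :=
  (∀ B ∈ Blocks, B.Nonempty) ∧
  (∀ A : {A : Finset E // A ∈ L}, ∃! B : Finset {A : Finset E // A ∈ L},
      B ∈ Blocks ∧ A ∈ B) ∧
  (∀ g ∈ toggleGroup L, ∀ B ∈ Blocks, Finset.image g B ∈ Blocks)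

/-- An element `g` of `T(L)` is type 2 (with respect to a fixed block system `Blocks`)
if it maps each block to itself; it is type 1 otherwise. -/
def IsType2 (L : Finset (Finset E)) (Blocks : Finset (Finset {A : Finset E // A ∈ L}))
    (g : Equiv.Perm {A : Finset E // A ∈ L}) : Prop :=
  ∀ B ∈ Blocks, Finset.image g B = B

/-- The action of `T(L)` on `L` is primitive: it is transitive and the only blocks
are the singletons, the empty set and the whole set. -/
def IsPrimitive (L : Finset (Finset E)) : Prop :=
  IsTransitive L ∧
    ∀ B : Finset {A : Finset E // A ∈ L}, IsBlock L B → B.card ≤ 1 ∨ B = Finset.univ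

/-- `T(L)` contains a long cycle, i.e. a cycle whose support is all of `L`. -/
def HasLongCycle (L : Finset (Finset E)) : Prop :=
  ∃ g ∈ toggleGroup L, g.IsCycle ∧ g.support = Finset.univ

theorem toggle_val_eq_or (L : Finset (Finset E)) (e : E) (X : {A : Finset E // A ∈ L}) :
    toggle L e X = X ∨ (toggle L e X).1 = X.1 ∆ {e} := by
  by_cases h : X.1 ∆ ({e} : Finset E) ∈ L
  · exact .inr (congrArg Subtype.val (dif_pos h))
  · exact .inl (dif_neg h)

theorem toggle_inv (L : Finset (Finset E)) (e : E) : (toggle L e)⁻¹ = toggle L e := rfl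

theorem toggle_mem_toggleGroup (L : Finset (Finset E)) (e : E) : toggle L e ∈ toggleGroup L :=
  Subgroup.subset_closure ⟨e, rfl⟩

theorem toggle_val_inter (L : Finset (Finset E)) {e : E} {S : Finset E} (he : e ∉ S)
    (X : {A : Finset E // A ∈ L}) : (toggle L e X).1 ∩ S = X.1 ∩ S := by
  rcases toggle_val_eq_or L e X with h | h
  · rw [h]
  · rw [h]
    ext a
    by_cases ha : a = e
    · simp [ha, he]
    · simp [Finset.mem_symmDiff, ha]

/-- Two members of `L` lie in a common block. -/
def SameBlock (L : Finset (Finset E)) (Blocks : Finset (Finset {A : Finset E // A ∈ L}))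
    (X Y : {A : Finset E // A ∈ L}) : Prop :=
  ∃ B ∈ Blocks, X ∈ B ∧ Y ∈ B

section Blocks

variable {L : Finset (Finset E)} {Blocks : Finset (Finset {A : Finset E // A ∈ L})}

theorem IsBlockSystem.eq_of_mem (hBS : IsBlockSystem L Blocks)
    {B C : Finset {A : Finset E // A ∈ L}} (hB : B ∈ Blocks) (hC : C ∈ Blocks)
    {X : {A : Finset E // A ∈ L}} (hXB : X ∈ B) (hXC : X ∈ C) : B = C :=
  (hBS.2.1 X).unique ⟨hB, hXB⟩ ⟨hC, hXC⟩

theorem IsBlockSystem.sameBlock_refl (hBS : IsBlockSystem L Blocks)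
    (X : {A : Finset E // A ∈ L}) : SameBlock L Blocks X X := by
  obtain ⟨B, ⟨hB, hX⟩, -⟩ := hBS.2.1 X
  exact ⟨B, hB, hX, hX⟩

theorem SameBlock.mem (hBS : IsBlockSystem L Blocks) {X Y : {A : Finset E // A ∈ L}}
    (h : SameBlock L Blocks X Y) {B : Finset {A : Finset E // A ∈ L}} (hB : B ∈ Blocks)
    (hY : Y ∈ B) : X ∈ B := by
  obtain ⟨C, hC, hXC, hYC⟩ := h
  rwa [hBS.eq_of_mem hB hC hY hYC]

theorem SameBlock.trans (hBS : IsBlockSystem L Blocks) {X Y Z : {A : Finset E // A ∈ L}}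
    (h : SameBlock L Blocks X Y) (h' : SameBlock L Blocks Y Z) : SameBlock L Blocks X Z := by
  obtain ⟨B, hB, hY, hZ⟩ := h'
  exact ⟨B, hB, h.mem hBS hB hY, hZ⟩

theorem SameBlock.apply (hBS : IsBlockSystem L Blocks) {X Y : {A : Finset E // A ∈ L}}
    (h : SameBlock L Blocks X Y) {g : Equiv.Perm {A : Finset E // A ∈ L}}
    (hg : g ∈ toggleGroup L) : SameBlock L Blocks (g X) (g Y) := by
  obtain ⟨B, hB, hX, hY⟩ := h
  exact ⟨_, hBS.2.2 g hg B hB, Finset.mem_image_of_mem _ hX, Finset.mem_image_of_mem _ hY⟩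

theorem IsType2.sameBlock (hBS : IsBlockSystem L Blocks)
    {g : Equiv.Perm {A : Finset E // A ∈ L}} (hg : IsType2 L Blocks g)
    (X : {A : Finset E // A ∈ L}) : SameBlock L Blocks X (g X) := by
  obtain ⟨B, ⟨hB, hX⟩, -⟩ := hBS.2.1 X
  refine ⟨B, hB, hX, ?_⟩
  rw [← hg B hB]
  exact Finset.mem_image_of_mem _ hX

theorem image_eq_of_mem (hBS : IsBlockSystem L Blocks)
    {g : Equiv.Perm {A : Finset E // A ∈ L}} (hg : g ∈ toggleGroup L)
    {B : Finset {A : Finset E // A ∈ L}} (hB : B ∈ Blocks) {X : {A : Finset E // A ∈ L}}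
    (hX : X ∈ B) (hgX : g X ∈ B) : Finset.image g B = B :=
  hBS.eq_of_mem (hBS.2.2 g hg B hB) hB (Finset.mem_image_of_mem _ hX) hgX

theorem list_prod_mem_toggleGroup (l : List E) :
    (l.map (toggle L)).prod ∈ toggleGroup L := by
  refine Subgroup.list_prod_mem _ fun g hg => ?_
  obtain ⟨e, -, rfl⟩ := List.mem_map.1 hg
  exact toggle_mem_toggleGroup L e

/-- If type 1 toggles stabilizing a block fix it pointwise, then the action of a type 1 toggle
on the type 1 coordinates depends only on these coordinates and the block. -/
theorem SameBlock.toggle_inter_eq (hBS : IsBlockSystem L Blocks) {e : E} {S : Finset E}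
    (hfix : ∀ B ∈ Blocks, Finset.image (toggle L e) B = B → ∀ A ∈ B, toggle L e A = A)
    {X Y : {A : Finset E // A ∈ L}} (h : SameBlock L Blocks X Y) (hS : X.1 ∩ S = Y.1 ∩ S) :
    (toggle L e X).1 ∩ S = (toggle L e Y).1 ∩ S := by
  obtain ⟨B, hB, hX, hY⟩ := h
  by_cases hi : Finset.image (toggle L e) B = B
  · rw [hfix B hB hi X hX, hfix B hB hi Y hY, hS]
  · have key : ∀ Z ∈ B, (toggle L e Z).1 = Z.1 ∆ {e} := fun Z hZ =>
      (toggle_val_eq_or L e Z).resolve_left fun hf =>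
        hi (image_eq_of_mem hBS (toggle_mem_toggleGroup L e) hB hZ (hf.symm ▸ hZ))
    rw [key X hX, key Y hY]
    ext a
    have := Finset.ext_iff.1 hS a
    simp only [Finset.mem_inter, Finset.mem_symmDiff] at this ⊢
    tauto

/-- Every group element can be replaced, up to blocks and type 1 coordinates, by a product of
type 1 toggles. -/
theorem exists_type1_list (hBS : IsBlockSystem L Blocks) {E₁ E₂ : Finset E}
    (hE₁ : ∀ x : E, x ∈ E₁ ↔ ¬ IsType2 L Blocks (toggle L x))
    (hE₂ : ∀ x : E, x ∈ E₂ ↔ IsType2 L Blocks (toggle L x))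
    (hfix : ∀ e ∈ E₁, ∀ B ∈ Blocks, Finset.image (toggle L e) B = B →
      ∀ A ∈ B, toggle L e A = A)
    (A : {A : Finset E // A ∈ L}) {g : Equiv.Perm {A : Finset E // A ∈ L}}
    (hg : g ∈ toggleGroup L) :
    ∃ l : List E, (∀ e ∈ l, ¬ IsType2 L Blocks (toggle L e)) ∧
      SameBlock L Blocks ((l.map (toggle L)).prod A) (g A) ∧
      ((l.map (toggle L)).prod A).1 ∩ E₁ = (g A).1 ∩ E₁ ∧
      ((l.map (toggle L)).prod A).1 ∩ E₂ = A.1 ∩ E₂ := by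
  have step : ∀ e : E, ∀ g : Equiv.Perm {A : Finset E // A ∈ L},
      (∃ l : List E, (∀ e ∈ l, ¬ IsType2 L Blocks (toggle L e)) ∧
        SameBlock L Blocks ((l.map (toggle L)).prod A) (g A) ∧
        ((l.map (toggle L)).prod A).1 ∩ E₁ = (g A).1 ∩ E₁ ∧
        ((l.map (toggle L)).prod A).1 ∩ E₂ = A.1 ∩ E₂) →
      ∃ l : List E, (∀ e ∈ l, ¬ IsType2 L Blocks (toggle L e)) ∧
        SameBlock L Blocks ((l.map (toggle L)).prod A) ((toggle L e * g) A) ∧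
        ((l.map (toggle L)).prod A).1 ∩ E₁ = ((toggle L e * g) A).1 ∩ E₁ ∧
        ((l.map (toggle L)).prod A).1 ∩ E₂ = A.1 ∩ E₂ := by
    rintro e g ⟨l, hl, hb, h1, h2⟩
    by_cases he : IsType2 L Blocks (toggle L e)
    · refine ⟨l, hl, hb.trans hBS (he.sameBlock hBS _), ?_, h2⟩
      rw [h1, Equiv.Perm.mul_apply, toggle_val_inter L (by simpa [hE₁] using he)]
    · refine ⟨e :: l, by simpa using ⟨he, hl⟩, ?_⟩
      simp only [List.map_cons, List.prod_cons, Equiv.Perm.mul_apply]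
      refine ⟨hb.apply hBS (toggle_mem_toggleGroup L e),
        hb.toggle_inter_eq hBS (hfix e ((hE₁ e).2 he)) h1, ?_⟩
      rw [toggle_val_inter L (by simpa [hE₂] using he), h2]
  refine Subgroup.closure_induction_left
    (p := fun g _ => ∃ l : List E, (∀ e ∈ l, ¬ IsType2 L Blocks (toggle L e)) ∧
      SameBlock L Blocks ((l.map (toggle L)).prod A) (g A) ∧
      ((l.map (toggle L)).prod A).1 ∩ E₁ = (g A).1 ∩ E₁ ∧
      ((l.map (toggle L)).prod A).1 ∩ E₂ = A.1 ∩ E₂) ?_ ?_ ?_ hg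
  · exact ⟨[], by simp, by simpa using hBS.sameBlock_refl A, by simp, by simp⟩
  · rintro _ ⟨e, rfl⟩ g _ ih
    exact step e g ih
  · rintro _ ⟨e, rfl⟩ g _ ih
    rw [toggle_inv]
    exact step e g ih

end Blocks

/-- if every product of type 1 toggles stabilizing a block fixes it
pointwise, then `L` is the toggle-disjoint Cartesian product of its projections to
the type 1 and type 2 coordinates, with `|L₁|` the number of blocks and `|L₂|` the
size of each block. -/
theorem cartesian_product_decomposition
    [Fintype E] (L : Finset (Finset E))
    (hnt : ∀ e : E, toggle L e ≠ 1)
    (htrans : IsTransitive L)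
    (Blocks : Finset (Finset {A : Finset E // A ∈ L}))
    (hBS : IsBlockSystem L Blocks)
    (E₁ E₂ : Finset E)
    (hE₁ : ∀ x : E, x ∈ E₁ ↔ ¬ IsType2 L Blocks (toggle L x))
    (hE₂ : ∀ x : E, x ∈ E₂ ↔ IsType2 L Blocks (toggle L x))
    (L₁ L₂ : Finset (Finset E))
    (hL₁ : ∀ S : Finset E, S ∈ L₁ ↔ ∃ A ∈ L, S = A ∩ E₁)
    (hL₂ : ∀ S : Finset E, S ∈ L₂ ↔ ∃ A ∈ L, S = A ∩ E₂)
    (hfix : ∀ l : List E, (∀ e ∈ l, ¬ IsType2 L Blocks (toggle L e)) →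
      ∀ B ∈ Blocks, Finset.image ((l.map (toggle L)).prod) B = B →
        ∀ A ∈ B, (l.map (toggle L)).prod A = A) :
    (∀ A : Finset E, A ∈ L ↔ ∃ X₁ ∈ L₁, ∃ X₂ ∈ L₂, A = X₁ ∪ X₂) ∧
    L₁.card = Blocks.card ∧ (∀ B ∈ Blocks, B.card = L₂.card) := by
  have hunion : ∀ A : Finset E, A ∩ E₁ ∪ A ∩ E₂ = A := by
    intro A
    ext a
    simp only [Finset.mem_union, Finset.mem_inter, hE₁, hE₂]
    tauto
  have hext : ∀ A A' : Finset E, A ∩ E₁ = A' ∩ E₁ → A ∩ E₂ = A' ∩ E₂ → A = A' := by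
    intro A A' h1 h2
    rw [← hunion A, ← hunion A', h1, h2]
  have reach : ∀ A A' : {A : Finset E // A ∈ L},
      ∃ l : List E, (∀ e ∈ l, ¬ IsType2 L Blocks (toggle L e)) ∧
        SameBlock L Blocks ((l.map (toggle L)).prod A) A' ∧
        ((l.map (toggle L)).prod A).1 ∩ E₁ = A'.1 ∩ E₁ ∧
        ((l.map (toggle L)).prod A).1 ∩ E₂ = A.1 ∩ E₂ := by
    intro A A'
    obtain ⟨g, hg, rfl⟩ := htrans A A'
    refine exists_type1_list hBS hE₁ hE₂ (fun e he => ?_) A hg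
    simpa using hfix [e] (by simpa using (hE₁ e).1 he)
  have same_iff : ∀ A A' : {A : Finset E // A ∈ L},
      SameBlock L Blocks A A' ↔ A.1 ∩ E₁ = A'.1 ∩ E₁ := by
    intro A A'
    obtain ⟨l, hl, hb, h1, h2⟩ := reach A A'
    constructor
    · rintro ⟨B, hB, hA, hA'⟩
      rw [← h1, hfix l hl B hB (image_eq_of_mem hBS (list_prod_mem_toggleGroup l) hB hA
        (hb.mem hBS hB hA')) A hA]
    · intro h
      rwa [Subtype.ext (hext _ _ (h1.trans h.symm) h2)] at hb
  refine ⟨fun A => ⟨fun hA => ⟨A ∩ E₁, (hL₁ _).2 ⟨A, hA, rfl⟩, A ∩ E₂,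
    (hL₂ _).2 ⟨A, hA, rfl⟩, (hunion A).symm⟩, ?_⟩, ?_, ?_⟩
  · rintro ⟨X₁, hX₁, X₂, hX₂, rfl⟩
    obtain ⟨A, hA, rfl⟩ := (hL₁ _).1 hX₁
    obtain ⟨A', hA', rfl⟩ := (hL₂ _).1 hX₂
    obtain ⟨l, -, -, h1, h2⟩ := reach ⟨A', hA'⟩ ⟨A, hA⟩
    rw [← h1, ← h2, hunion]
    exact Subtype.prop _
  · symm
    refine Finset.card_bij (fun B hB => (hBS.1 B hB).choose.1 ∩ E₁) ?_ ?_ ?_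
    · intro B hB
      exact (hL₁ _).2 ⟨_, Subtype.prop _, rfl⟩
    · intro B hB C hC h
      have hBC := ((same_iff _ _).2 h).mem hBS hC (hBS.1 C hC).choose_spec
      exact hBS.eq_of_mem hB hC (hBS.1 B hB).choose_spec hBC
    · intro S hS
      obtain ⟨A, hA, rfl⟩ := (hL₁ _).1 hS
      obtain ⟨B, ⟨hB, hAB⟩, -⟩ := hBS.2.1 ⟨A, hA⟩
      exact ⟨B, hB, (same_iff _ ⟨A, hA⟩).1 ⟨B, hB, (hBS.1 B hB).choose_spec, hAB⟩⟩
  · intro B hB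
    refine Finset.card_bij (fun A _ => A.1 ∩ E₂) ?_ ?_ ?_
    · intro A _
      exact (hL₂ _).2 ⟨_, A.2, rfl⟩
    · intro A hA A' hA' h
      exact Subtype.ext (hext _ _ ((same_iff _ _).1 ⟨B, hB, hA, hA'⟩) h)
    · intro S hS
      obtain ⟨A, hA, rfl⟩ := (hL₂ _).1 hS
      obtain ⟨A', hA'⟩ := hBS.1 B hB
      obtain ⟨l, -, hb, -, h2⟩ := reach ⟨A, hA⟩ A'
      exact ⟨_, hb.mem hBS hB hA', h2⟩

end TogglePaper
end

section
/- Suppose T(𝓛) is imprimitive with a block system whose blocks have odd size. Then 𝓛 is a toggle-disjoint Cartesian product of two sets, each of which has at least two elements: there exist disjoint sets E₁, E₂ ⊆ E and collections 𝓛₁ of subsets of E₁ and 𝓛₂ of subsets of E₂, with |𝓛₁| ≥ 2 and |𝓛₂| ≥ 2, such that 𝓛 = {X₁ ∪ X₂ : X₁ ∈ 𝓛₁, X₂ ∈ 𝓛₂}. -/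
open scoped symmDiff

namespace TogglePaper

variable {E : Type*} [DecidableEq E]

section Congruence

variable {L : Finset (Finset E)}

/-- The equivalence relation `s` is a congruence for the action of `T(L)`. -/
def IsCongruence (s : Setoid {A : Finset E // A ∈ L}) : Prop :=
  ∀ g ∈ toggleGroup L, ∀ X Y, s X Y → s (g X) (g Y)

/-- The toggle `τ_e` moves some class of `s`. -/
def MovesClass (s : Setoid {A : Finset E // A ∈ L}) (e : E) : Prop :=
  ∃ X, ¬ s X (toggle L e X)

lemma toggle_mem (e : E) : toggle L e ∈ toggleGroup L :=
  Subgroup.subset_closure ⟨e, rfl⟩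

lemma toggle_apply_of_mem {e : E} {X : {A : Finset E // A ∈ L}}
    (h : X.1 ∆ ({e} : Finset E) ∈ L) : toggle L e X = ⟨X.1 ∆ {e}, h⟩ :=
  dif_pos h

lemma toggle_apply_of_notMem {e : E} {X : {A : Finset E // A ∈ L}}
    (h : X.1 ∆ ({e} : Finset E) ∉ L) : toggle L e X = X :=
  dif_neg h

lemma toggle_toggle (e : E) (X : {A : Finset E // A ∈ L}) :
    toggle L e (toggle L e X) = X :=
  Function.Involutive.toPerm_involutive _ X

lemma toggle_ne_iff {e : E} {X : {A : Finset E // A ∈ L}} :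
    toggle L e X ≠ X ↔ X.1 ∆ ({e} : Finset E) ∈ L := by
  by_cases h : X.1 ∆ ({e} : Finset E) ∈ L
  · simp [toggle_apply_of_mem h, h, Subtype.ext_iff]
  · simp [toggle_apply_of_notMem h, h]

lemma mem_toggle_of_ne {e f : E} (hef : f ≠ e) (X : {A : Finset E // A ∈ L}) :
    f ∈ (toggle L e X).1 ↔ f ∈ X.1 := by
  by_cases h : X.1 ∆ ({e} : Finset E) ∈ L
  · simp [toggle_apply_of_mem h, Finset.mem_symmDiff, hef]
  · simp [toggle_apply_of_notMem h]

lemma mem_toggle_self {e : E} {X : {A : Finset E // A ∈ L}} (h : toggle L e X ≠ X) :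
    e ∈ (toggle L e X).1 ↔ e ∉ X.1 := by
  simp [toggle_apply_of_mem (toggle_ne_iff.1 h), Finset.mem_symmDiff]

/-- If `τ_e` and `τ_f` move `X` and `τ_f` moves `τ_e X`, then they commute at `X`. -/
lemma toggle_toggle_eq {e f : E} {X : {A : Finset E // A ∈ L}}
    (he : toggle L e X ≠ X) (hf : toggle L f X ≠ X)
    (hfe : toggle L f (toggle L e X) ≠ toggle L e X) :
    toggle L e (toggle L f X) = toggle L f (toggle L e X) := by
  have h1 := toggle_ne_iff.1 he
  have h2 := toggle_ne_iff.1 hf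
  have h3 := toggle_ne_iff.1 hfe
  rw [toggle_apply_of_mem h3]
  have h4 : (toggle L f X).1 ∆ ({e} : Finset E) = (toggle L e X).1 ∆ {f} := by
    simp [toggle_apply_of_mem h1, toggle_apply_of_mem h2, symmDiff_right_comm]
  rw [toggle_apply_of_mem (h4 ▸ h3)]
  exact Subtype.ext h4

lemma IsTransitive.induction (htrans : IsTransitive L)
    {P : {A : Finset E // A ∈ L} → Prop} (X : {A : Finset E // A ∈ L}) (hX : P X)
    (hstep : ∀ e Y, P Y → P (toggle L e Y)) (Y : {A : Finset E // A ∈ L}) : P Y := by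
  obtain ⟨g, hg, rfl⟩ := htrans X Y
  suffices h : ∀ Y, P (g Y) ↔ P Y from (h X).2 hX
  clear hX
  induction hg using Subgroup.closure_induction with
  | mem g hg =>
    obtain ⟨e, rfl⟩ := hg
    exact fun Y => ⟨fun h => by simpa [toggle_toggle] using hstep e _ h, hstep e Y⟩
  | one => simp
  | mul g h _ _ ihg ihh => exact fun Y => (ihg (h Y)).trans (ihh Y)
  | inv g _ ih => exact fun Y => by simpa using (ih (g⁻¹ Y)).symm

namespace IsCongruence

variable {s : Setoid {A : Finset E // A ∈ L}}

lemma rel_toggle (hs : IsCongruence s) (e : E) {X Y : {A : Finset E // A ∈ L}} (h : s X Y) :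
    s (toggle L e X) (toggle L e Y) :=
  hs _ (toggle_mem e) _ _ h

/-- A toggle that moves some class never moves an element inside its class. -/
lemma not_rel_toggle (hs : IsCongruence s) (htrans : IsTransitive L) {e : E}
    (he : MovesClass s e) (X : {A : Finset E // A ∈ L}) (hX : toggle L e X ≠ X) :
    ¬ s X (toggle L e X) := by
  obtain ⟨X₀, hX₀⟩ := he
  suffices h : ∀ Y, ∀ Z, s Y Z → toggle L e Z ≠ Z →
      ¬ s Z (toggle L e Z) from h X X (s.refl X) hX
  refine htrans.induction X₀ ?_ ?_
  · intro Z hZ _ h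
    exact hX₀ (s.trans (s.trans hZ h) (hs.rel_toggle e (s.symm hZ)))
  · intro f Y ih Z hYZ hne hZ
    have hY : s Y (toggle L f Z) := by
      simpa [toggle_toggle] using hs.rel_toggle f hYZ
    by_cases hfe : f = e
    · subst hfe
      exact ih Z (s.trans hY (s.symm hZ)) hne hZ
    by_cases hf : s Z (toggle L f Z)
    · exact ih Z (s.trans hY (s.symm hf)) hne hZ
    have hfZ : toggle L f Z ≠ Z := fun h => hf (by rw [h])
    have hfeZ : toggle L f (toggle L e Z) ≠ toggle L e Z := by
      intro h
      have h1 := hs.rel_toggle f hZ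
      rw [h] at h1
      exact hf (s.trans hZ (s.symm h1))
    have hcomm := toggle_toggle_eq hne hfZ hfeZ
    refine ih _ hY ?_ ?_
    · rw [hcomm]
      exact fun h => hne ((toggle L f).injective h)
    · rw [hcomm]
      exact hs.rel_toggle f hZ

/-- A toggle that moves some class moves either all or no elements of a class. -/
lemma toggle_ne_of_rel (hs : IsCongruence s) (htrans : IsTransitive L) {e : E}
    (he : MovesClass s e) {X Y : {A : Finset E // A ∈ L}} (hXY : s X Y)
    (hX : toggle L e X ≠ X) : toggle L e Y ≠ Y := by
  intro hY
  have h := hs.rel_toggle e hXY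
  rw [hY] at h
  exact hs.not_rel_toggle htrans he X hX (s.trans hXY (s.symm h))

lemma commute_toggle (hs : IsCongruence s) (htrans : IsTransitive L) {e f : E}
    (he : MovesClass s e) (hf : ¬ MovesClass s f) :
    Commute (toggle L e) (toggle L f) := by
  have hf' : ∀ X, s X (toggle L f X) := by simpa [MovesClass] using hf
  ext1 X
  simp only [Equiv.Perm.mul_apply]
  by_cases hfX : toggle L f X = X
  · by_cases hfeX : toggle L f (toggle L e X) = toggle L e X
    · rw [hfX, hfeX]
    · exfalso
      have heX : toggle L e X ≠ X := fun h => hfeX (by rw [h, hfX])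
      have h1 : toggle L e (toggle L e X) ≠ toggle L e X := by
        rw [toggle_toggle]; exact heX.symm
      have h2 := hs.toggle_ne_of_rel htrans he (hf' (toggle L e X)) h1
      have h3 : toggle L f (toggle L e (toggle L e X)) =
          toggle L e (toggle L e X) := by
        rw [toggle_toggle, hfX]
      have hef : e ≠ f := by rintro rfl; exact heX hfX
      have h4 := toggle_ne_iff.1 h2
      have h5 := toggle_ne_iff.1 hfeX
      have h6 := toggle_ne_iff.1 heX
      have h7 : X.1 ∆ ({f} : Finset E) ∈ L := by
        have h8 : (toggle L f (toggle L e X)).1 ∆ ({e} : Finset E) =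
            X.1 ∆ {f} := by
          rw [toggle_apply_of_mem h5]
          simp only [toggle_apply_of_mem h6]
          rw [symmDiff_right_comm, symmDiff_symmDiff_cancel_right]
        exact h8 ▸ h4
      exact toggle_ne_iff.2 h7 hfX
  · by_cases heX : toggle L e X = X
    · rw [heX]
      by_contra h
      exact hs.toggle_ne_of_rel htrans he (s.symm (hf' X)) h heX
    · have h := hs.toggle_ne_of_rel htrans he (hf' X) heX
      exact (toggle_toggle_eq hfX heX h).symm

/-- All elements of a class change at a class-moving coordinate `e` simultaneously. -/
lemma mem_iff_mem_iff (hs : IsCongruence s) (htrans : IsTransitive L) {e : E}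
    (he : MovesClass s e) {g : Equiv.Perm {A : Finset E // A ∈ L}} (hg : g ∈ toggleGroup L) :
    ∀ X Y, s X Y → ((e ∈ (g X).1 ↔ e ∈ X.1) ↔ (e ∈ (g Y).1 ↔ e ∈ Y.1)) := by
  induction hg using Subgroup.closure_induction with
  | mem g hg =>
    obtain ⟨f, rfl⟩ := hg
    intro X Y hXY
    by_cases hfe : e = f
    · subst hfe
      by_cases hX : toggle L e X = X
      · have hY : toggle L e Y = Y := by
          by_contra hY
          exact hs.toggle_ne_of_rel htrans he (s.symm hXY) hY hX
        simp [hX, hY]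
      · have hY := hs.toggle_ne_of_rel htrans he hXY hX
        simp [mem_toggle_self hX, mem_toggle_self hY]
    · simp [mem_toggle_of_ne hfe]
  | one => simp
  | mul g h hg hh ihg ihh =>
    intro X Y hXY
    have h1 := ihg _ _ (hs h hh X Y hXY)
    have h2 := ihh X Y hXY
    simp only [Equiv.Perm.mul_apply]
    tauto
  | inv g hg ih =>
    intro X Y hXY
    have h1 := ih _ _ (hs g⁻¹ (inv_mem hg) X Y hXY)
    simp only [Equiv.Perm.coe_inv, Equiv.apply_symm_apply] at h1
    tauto

/-- On a finite class of odd size, membership of a class-moving coordinate is constant. -/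
lemma mem_iff_of_odd (hs : IsCongruence s) (htrans : IsTransitive L) {e : E}
    (he : MovesClass s e) {X Y : {A : Finset E // A ∈ L}} {B : Finset {A : Finset E // A ∈ L}}
    (hB : ∀ Z, Z ∈ B ↔ s X Z) (hodd : Odd B.card) (hXY : s X Y) : e ∈ X.1 ↔ e ∈ Y.1 := by
  obtain ⟨g, hg, rfl⟩ := htrans X Y
  by_contra hne
  have hflip : ∀ Z ∈ B, (e ∈ (g Z).1 ↔ e ∉ Z.1) := by
    intro Z hZ
    have := hs.mem_iff_mem_iff htrans he hg X Z ((hB Z).1 hZ)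
    tauto
  have hgB : ∀ Z, g Z ∈ B ↔ Z ∈ B := by
    intro Z
    rw [hB, hB]
    constructor
    · intro h
      simpa using hs g⁻¹ (inv_mem hg) _ _ (s.trans (s.symm hXY) h)
    · exact fun h => s.trans hXY (hs g hg _ _ h)
  have hcard : (B.filter (fun Z => e ∈ Z.1)).card = (B.filter (fun Z => ¬ e ∈ Z.1)).card := by
    refine Finset.card_bij (fun Z _ => g Z) ?_ (fun _ _ _ _ h => g.injective h) ?_
    · intro Z hZ
      rw [Finset.mem_filter] at hZ ⊢
      refine ⟨(hgB Z).2 hZ.1, ?_⟩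
      rw [hflip Z hZ.1]
      exact not_not.2 hZ.2
    · intro Z hZ
      rw [Finset.mem_filter] at hZ
      have h1 : g⁻¹ Z ∈ B := (hgB _).1 (by simpa using hZ.1)
      refine ⟨g⁻¹ Z, ?_, by simp⟩
      rw [Finset.mem_filter]
      refine ⟨h1, ?_⟩
      have := hflip _ h1
      simp only [Equiv.Perm.coe_inv, Equiv.apply_symm_apply] at this
      have := hZ.2
      tauto
  have hsum := Finset.card_filter_add_card_filter_not (s := B) (fun Z => e ∈ Z.1)
  rw [← hsum, ← hcard] at hodd
  exact (Nat.not_odd_iff_even.2 ⟨_, rfl⟩) hodd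

/-- The coordinates of `X` at class-moving toggles can be combined with those of `Y` at the
other toggles. -/
lemma exists_mem_iff (hs : IsCongruence s) (htrans : IsTransitive L)
    (X Y : {A : Finset E // A ∈ L}) :
    ∃ Z : {A : Finset E // A ∈ L}, (∀ e, MovesClass s e → (e ∈ Z.1 ↔ e ∈ X.1)) ∧
      ∀ e, ¬ MovesClass s e → (e ∈ Z.1 ↔ e ∈ Y.1) := by
  let T := Subgroup.closure (toggle L '' {e | MovesClass s e})
  have hT : ∀ g ∈ T, ∀ f, ¬ MovesClass s f → ∀ Y, (f ∈ (g Y).1 ↔ f ∈ Y.1) := by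
    intro g hg f hf
    induction hg using Subgroup.closure_induction with
    | mem g hg =>
      obtain ⟨e, he, rfl⟩ := hg
      exact mem_toggle_of_ne (by rintro rfl; exact hf he)
    | one => simp
    | mul g h _ _ ihg ihh => exact fun Y => (ihg (h Y)).trans (ihh Y)
    | inv g _ ih => exact fun Y => by simpa using (ih (g⁻¹ Y)).symm
  have hcomm : ∀ g ∈ T, ∀ f, ¬ MovesClass s f → Commute g (toggle L f) := by
    intro g hg f hf
    induction hg using Subgroup.closure_induction with
    | mem g hg =>
      obtain ⟨e, he, rfl⟩ := hg
      exact hs.commute_toggle htrans he hf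
    | one => exact Commute.one_left _
    | mul g h _ _ ihg ihh => exact ihg.mul_left ihh
    | inv g _ ih => exact ih.inv_left
  suffices h : ∃ g ∈ T, ∀ e, MovesClass s e → (e ∈ (g Y).1 ↔ e ∈ X.1) by
    obtain ⟨g, hg, hgX⟩ := h
    exact ⟨g Y, hgX, fun e he => hT g hg e he Y⟩
  revert Y
  refine htrans.induction X ⟨1, one_mem _, by simp⟩ ?_
  rintro f Y ⟨g, hg, hgX⟩
  by_cases hf : MovesClass s f
  · refine ⟨g * toggle L f,
      mul_mem hg (Subgroup.subset_closure ⟨f, hf, rfl⟩), ?_⟩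
    simpa [toggle_toggle] using hgX
  · refine ⟨g, hg, fun e he => ?_⟩
    have h : g (toggle L f Y) = toggle L f (g Y) :=
      DFunLike.congr_fun (hcomm g hg f hf).eq Y
    rw [h, mem_toggle_of_ne (by rintro rfl; exact hf he)]
    exact hgX e he

end IsCongruence

/-- The equivalence relation of lying in a common block. -/
def IsBlockSystem.setoid {Blocks : Finset (Finset {A : Finset E // A ∈ L})}
    (hBS : IsBlockSystem L Blocks) : Setoid {A : Finset E // A ∈ L} where
  r X Y := ∃ B ∈ Blocks, X ∈ B ∧ Y ∈ B
  iseqv :=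
    { refl := fun X => by
        obtain ⟨B, ⟨hB, hX⟩, -⟩ := hBS.2.1 X
        exact ⟨B, hB, hX, hX⟩
      symm := fun ⟨B, hB, hX, hY⟩ => ⟨B, hB, hY, hX⟩
      trans := by
        rintro X Y Z ⟨B, hB, hX, hY⟩ ⟨C, hC, hY', hZ⟩
        obtain rfl := (hBS.2.1 Y).unique ⟨hB, hY⟩ ⟨hC, hY'⟩
        exact ⟨B, hB, hX, hZ⟩ }

lemma IsBlockSystem.isCongruence {Blocks : Finset (Finset {A : Finset E // A ∈ L})}
    (hBS : IsBlockSystem L Blocks) : IsCongruence hBS.setoid := by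
  rintro g hg X Y ⟨B, hB, hX, hY⟩
  exact ⟨_, hBS.2.2 g hg B hB, Finset.mem_image_of_mem _ hX, Finset.mem_image_of_mem _ hY⟩

lemma IsBlockSystem.mem_iff {Blocks : Finset (Finset {A : Finset E // A ∈ L})}
    (hBS : IsBlockSystem L Blocks) {B : Finset {A : Finset E // A ∈ L}} (hB : B ∈ Blocks)
    {X : {A : Finset E // A ∈ L}} (hX : X ∈ B) (Y : {A : Finset E // A ∈ L}) :
    Y ∈ B ↔ hBS.setoid X Y := by
  refine ⟨fun hY => ⟨B, hB, hX, hY⟩, ?_⟩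
  rintro ⟨C, hC, hX', hY⟩
  obtain rfl := (hBS.2.1 X).unique ⟨hB, hX⟩ ⟨hC, hX'⟩
  exact hY

end Congruence

/-- an imprimitive toggle group with blocks of odd size gives a
toggle-disjoint Cartesian product decomposition into two factors of size at least 2. -/
theorem odd_block_size_gives_cartesian_product
    [Fintype E] (L : Finset (Finset E))
    (hnt : ∀ e : E, toggle L e ≠ 1)
    (htrans : IsTransitive L)
    (Blocks : Finset (Finset {A : Finset E // A ∈ L}))
    (hBS : IsBlockSystem L Blocks)
    (himp : ∃ B ∈ Blocks, 1 < B.card ∧ B.card < L.card)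
    (hodd : ∀ B ∈ Blocks, Odd B.card) :
    ∃ E₁ E₂ : Finset E, Disjoint E₁ E₂ ∧
      ∃ L₁ L₂ : Finset (Finset E),
        (∀ X ∈ L₁, X ⊆ E₁) ∧ (∀ X ∈ L₂, X ⊆ E₂) ∧
        2 ≤ L₁.card ∧ 2 ≤ L₂.card ∧
        (∀ A : Finset E, A ∈ L ↔ ∃ X₁ ∈ L₁, ∃ X₂ ∈ L₂, A = X₁ ∪ X₂) := by
  classical
  obtain ⟨B, hB, hB1, hBL⟩ := himp
  obtain ⟨X, hX, Y, hY, hXY⟩ := Finset.one_lt_card.1 hB1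
  have hs := hBS.isCongruence
  have hBX := hBS.mem_iff hB hX
  have hmove : ∃ e, MovesClass hBS.setoid e := by
    by_contra! hno
    have hall : ∀ Z, hBS.setoid X Z := by
      refine htrans.induction X (hBS.setoid.refl X) fun e Z hZ => ?_
      exact hBS.setoid.trans hZ (not_not.1 fun h => hno e ⟨Z, h⟩)
    have hBuniv : B = Finset.univ := Finset.eq_univ_of_forall fun Z => (hBX Z).2 (hall Z)
    rw [hBuniv, Finset.card_univ, Fintype.card_coe] at hBL
    exact lt_irrefl _ hBL
  refine ⟨Finset.univ.filter (MovesClass hBS.setoid),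
    Finset.univ.filter (fun e => ¬ MovesClass hBS.setoid e),
    Finset.disjoint_filter_filter_not _ _ _,
    L.image (fun A => A.filter (MovesClass hBS.setoid)),
    L.image (fun A => A.filter (fun e => ¬ MovesClass hBS.setoid e)), ?_, ?_, ?_, ?_, ?_⟩
  · intro Z hZ
    obtain ⟨A, -, rfl⟩ := Finset.mem_image.1 hZ
    exact Finset.filter_subset_filter _ (Finset.subset_univ A)
  · intro Z hZ
    obtain ⟨A, -, rfl⟩ := Finset.mem_image.1 hZ
    exact Finset.filter_subset_filter _ (Finset.subset_univ A)
  · obtain ⟨e, he⟩ := hmove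
    obtain ⟨Z, hZ⟩ := id he
    have hne : toggle L e Z ≠ Z := fun h => hZ (by rw [h])
    refine Finset.one_lt_card.2 ⟨_, Finset.mem_image_of_mem _ Z.2,
      _, Finset.mem_image_of_mem _ (toggle L e Z).2, fun h => ?_⟩
    have h1 := Finset.ext_iff.1 h e
    simp only [Finset.mem_filter, he, and_true, mem_toggle_self hne] at h1
    tauto
  · refine Finset.one_lt_card.2 ⟨_, Finset.mem_image_of_mem _ X.2,
      _, Finset.mem_image_of_mem _ Y.2, fun h => hXY (Subtype.ext (Finset.ext fun e => ?_))⟩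
    by_cases he : MovesClass hBS.setoid e
    · exact hs.mem_iff_of_odd htrans he hBX (hodd B hB) ((hBX Y).1 hY)
    · simpa [he] using Finset.ext_iff.1 h e
  · intro A
    constructor
    · intro hA
      exact ⟨_, Finset.mem_image_of_mem _ hA, _, Finset.mem_image_of_mem _ hA,
        (Finset.filter_union_filter_not_eq _ A).symm⟩
    · rintro ⟨X₁, h₁, X₂, h₂, rfl⟩
      obtain ⟨A₁, hA₁, rfl⟩ := Finset.mem_image.1 h₁
      obtain ⟨A₂, hA₂, rfl⟩ := Finset.mem_image.1 h₂
      obtain ⟨Z, hZ₁, hZ₂⟩ := hs.exists_mem_iff htrans ⟨A₁, hA₁⟩ ⟨A₂, hA₂⟩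
      convert Z.2 using 1
      ext e
      by_cases he : MovesClass hBS.setoid e
      · simp [he, hZ₁ e he]
      · simp [he, hZ₂ e he]

end TogglePaper
end
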